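/- Let p ∈ ℂ² be a point with X₁(p) ≠ 0, and let ω be analytic in a neighborhood of p with X₁·∂₁ω + X₂·∂₂ω = 0 near p. Then for every integer j ≥ 1, in a neighborhood of p, X(∂₂^j ω) = Σ_{i=0}^{j−1} C(j, i+1)·Bᵢ·∂₂^{j−i}ω, where C(j, i+1) denotes the binomial coefficient 'j choose i+1'. -/

import Mathlib

open Filter MvPolynomial

/-- Evaluation of a polynomial in two variables at a point of `ℂ × ℂ`. -/
noncomputable def pev (P : MvPolynomial (Fin 2) ℂ) (p : ℂ × ℂ) : ℂ :=
  MvPolynomial.eval ![p.1, p.2] P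

/-- Partial derivative with respect to the first variable. -/
noncomputable def d1 : (ℂ × ℂ → ℂ) → (ℂ × ℂ → ℂ) :=
  fun f p => deriv (fun x => f (x, p.2)) p.1

/-- Partial derivative with respect to the second variable. -/
noncomputable def d2 : (ℂ × ℂ → ℂ) → (ℂ × ℂ → ℂ) :=
  fun f p => deriv (fun y => f (p.1, y)) p.2

/-- The differential operator `X(g) = X₁·∂₁g + X₂·∂₂g`. -/
noncomputable def Xop (X₁ X₂ : MvPolynomial (Fin 2) ℂ) (f : ℂ × ℂ → ℂ) : ℂ × ℂ → ℂ :=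
  fun p => pev X₁ p * d1 f p + pev X₂ p * d2 f p

/-- A first integral of `X` at `p`: a nonconstant function, analytic near `p`,
annihilated by `X` near `p`. -/
def IsFirstIntegralAt (X₁ X₂ : MvPolynomial (Fin 2) ℂ) (ω : ℂ × ℂ → ℂ) (p : ℂ × ℂ) : Prop :=
  AnalyticAt ℂ ω p ∧ (∀ᶠ q in nhds p, Xop X₁ X₂ ω q = 0) ∧
    ¬ ∃ c : ℂ, ∀ᶠ q in nhds p, ω q = c

/-- The functions `Bᵢ = −X₁·∂₂^{i+1}(X₂/X₁)`. -/
noncomputable def B (X₁ X₂ : MvPolynomial (Fin 2) ℂ) (i : ℕ) : ℂ × ℂ → ℂ :=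
  fun p => -(pev X₁ p) * (d2^[i + 1] (fun q => pev X₂ q / pev X₁ q)) p

theorem analyticAt_pev (P : MvPolynomial (Fin 2) ℂ) (p : ℂ × ℂ) : AnalyticAt ℂ (pev P) p := by
  have h : AnalyticAt ℂ (fun q : ℂ × ℂ => aeval ![q.1, q.2] P) p := by
    refine AnalyticAt.aeval_mvPolynomial (fun i => ?_) P
    fin_cases i
    · exact analyticAt_fst
    · exact analyticAt_snd
  simp only [aeval_eq_eval] at h
  exact h

theorem d1_eq_fderiv {f : ℂ × ℂ → ℂ} {p : ℂ × ℂ} (hf : DifferentiableAt ℂ f p) :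
    d1 f p = fderiv ℂ f p (1, 0) :=
  (HasFDerivAt.comp_hasDerivAt p.1 (f := fun x => (x, p.2)) hf.hasFDerivAt
    ((hasDerivAt_id p.1).prodMk (hasDerivAt_const p.1 p.2))).deriv

theorem d2_eq_fderiv {f : ℂ × ℂ → ℂ} {p : ℂ × ℂ} (hf : DifferentiableAt ℂ f p) :
    d2 f p = fderiv ℂ f p (0, 1) :=
  (HasFDerivAt.comp_hasDerivAt p.2 (f := fun y => (p.1, y)) hf.hasFDerivAt
    ((hasDerivAt_const p.2 p.1).prodMk (hasDerivAt_id p.2))).deriv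

theorem d1_eventuallyEq_fderiv {f : ℂ × ℂ → ℂ} {p : ℂ × ℂ} (hf : AnalyticAt ℂ f p) :
    d1 f =ᶠ[nhds p] fun q => fderiv ℂ f q (1, 0) :=
  hf.eventually_analyticAt.mono fun _ hq => d1_eq_fderiv hq.differentiableAt

theorem d2_eventuallyEq_fderiv {f : ℂ × ℂ → ℂ} {p : ℂ × ℂ} (hf : AnalyticAt ℂ f p) :
    d2 f =ᶠ[nhds p] fun q => fderiv ℂ f q (0, 1) :=
  hf.eventually_analyticAt.mono fun _ hq => d2_eq_fderiv hq.differentiableAt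

theorem analyticAt_fderiv_apply {f : ℂ × ℂ → ℂ} {p : ℂ × ℂ} (hf : AnalyticAt ℂ f p)
    (v : ℂ × ℂ) : AnalyticAt ℂ (fun q => fderiv ℂ f q v) p :=
  ((ContinuousLinearMap.apply ℂ ℂ v).analyticAt _).comp hf.fderiv

theorem AnalyticAt.d1 {f : ℂ × ℂ → ℂ} {p : ℂ × ℂ} (hf : AnalyticAt ℂ f p) :
    AnalyticAt ℂ (d1 f) p :=
  (analyticAt_fderiv_apply hf _).congr (d1_eventuallyEq_fderiv hf).symm

theorem AnalyticAt.d2 {f : ℂ × ℂ → ℂ} {p : ℂ × ℂ} (hf : AnalyticAt ℂ f p) :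
    AnalyticAt ℂ (d2 f) p :=
  (analyticAt_fderiv_apply hf _).congr (d2_eventuallyEq_fderiv hf).symm

theorem AnalyticAt.iterate_d2 {f : ℂ × ℂ → ℂ} {p : ℂ × ℂ} (hf : AnalyticAt ℂ f p) (j : ℕ) :
    AnalyticAt ℂ (_root_.d2^[j] f) p := by
  induction j with
  | zero => exact hf
  | succ j ih => rw [Function.iterate_succ_apply']; exact ih.d2

theorem d1_d2_comm {f : ℂ × ℂ → ℂ} {p : ℂ × ℂ} (hf : AnalyticAt ℂ f p) :
    d1 (d2 f) p = d2 (d1 f) p := by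
  have hd : DifferentiableAt ℂ (fderiv ℂ f) p := hf.fderiv.differentiableAt
  have key (v w : ℂ × ℂ) :
      fderiv ℂ (fun q => fderiv ℂ f q v) p w = fderiv ℂ (fderiv ℂ f) p w v := by
    rw [fderiv_clm_apply hd (differentiableAt_const v)]
    simp
  rw [d1_eq_fderiv hf.d2.differentiableAt, d2_eq_fderiv hf.d1.differentiableAt,
    (d2_eventuallyEq_fderiv hf).fderiv_eq, (d1_eventuallyEq_fderiv hf).fderiv_eq, key, key]
  exact hf.contDiffAt.isSymmSndFDerivAt_of_omega _ _

theorem Filter.EventuallyEq.d2 {f g : ℂ × ℂ → ℂ} {p : ℂ × ℂ} (h : f =ᶠ[nhds p] g) :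
    d2 f =ᶠ[nhds p] d2 g := by
  filter_upwards [h.eventuallyEq_nhds] with q hq
  have hc : Tendsto (fun y : ℂ => (q.1, y)) (nhds q.2) (nhds q) :=
    (Continuous.prodMk_right q.1).continuousAt
  exact EventuallyEq.deriv_eq (hc.eventually hq)

theorem Filter.EventuallyEq.iterate_d2 {f g : ℂ × ℂ → ℂ} {p : ℂ × ℂ} (h : f =ᶠ[nhds p] g)
    (j : ℕ) : _root_.d2^[j] f =ᶠ[nhds p] _root_.d2^[j] g := by
  induction j with
  | zero => exact h
  | succ j ih => simp only [Function.iterate_succ_apply']; exact ih.d2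

theorem d1_iterate_d2_comm {f : ℂ × ℂ → ℂ} {p : ℂ × ℂ} (hf : AnalyticAt ℂ f p) (j : ℕ) :
    d1 (d2^[j] f) =ᶠ[nhds p] d2^[j] (d1 f) := by
  induction j with
  | zero => rfl
  | succ j ih =>
    simp only [Function.iterate_succ_apply']
    refine EventuallyEq.trans ?_ ih.d2
    exact (hf.iterate_d2 j).eventually_analyticAt.mono fun _ hq => d1_d2_comm hq

theorem iterate_d2_apply (f : ℂ × ℂ → ℂ) (j : ℕ) (p : ℂ × ℂ) :
    d2^[j] f p = iteratedDeriv j (fun y => f (p.1, y)) p.2 := by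
  induction j generalizing p with
  | zero => rfl
  | succ j ih =>
    rw [Function.iterate_succ_apply', iteratedDeriv_succ]
    simp only [d2, ih]

/-- Leibniz rule for the iterated partial derivative in the second variable. -/
theorem iterate_d2_mul {f g : ℂ × ℂ → ℂ} {p : ℂ × ℂ} (hf : AnalyticAt ℂ f p)
    (hg : AnalyticAt ℂ g p) (j : ℕ) :
    d2^[j] (fun q => f q * g q) p =
      ∑ i ∈ Finset.range (j + 1), (j.choose i : ℂ) * d2^[i] f p * d2^[j - i] g p := by
  have slice {h : ℂ × ℂ → ℂ} (hh : AnalyticAt ℂ h p) :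
      ContDiffAt ℂ j (fun y => h (p.1, y)) p.2 :=
    (hh.comp (f := fun y => (p.1, y)) (analyticAt_const.prod analyticAt_id)).contDiffAt
  simp only [iterate_d2_apply]
  exact iteratedDeriv_mul (slice hf) (slice hg)

theorem iterate_d2_succ_sub (f : ℂ × ℂ → ℂ) {i j : ℕ} (h : i < j) :
    d2^[j - (i + 1)] (d2 f) = d2^[j - i] f := by
  rw [← Function.iterate_succ_apply]
  congr 2
  omega

/-- for a local first integral `ω`,
`X(∂₂^j ω) = Σ_{i=0}^{j−1} C(j,i+1)·Bᵢ·∂₂^{j−i}ω` near a point where `X₁ ≠ 0`. -/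
theorem stmt_10 (X₁ X₂ : MvPolynomial (Fin 2) ℂ) (p : ℂ × ℂ)
    (hX₁ : pev X₁ p ≠ 0) (ω : ℂ × ℂ → ℂ) (hω : AnalyticAt ℂ ω p)
    (hωX : ∀ᶠ q in nhds p, Xop X₁ X₂ ω q = 0) :
    ∀ j : ℕ, 1 ≤ j → ∀ᶠ q in nhds p,
      Xop X₁ X₂ (d2^[j] ω) q =
        ∑ i ∈ Finset.range j,
          (Nat.choose j (i + 1) : ℂ) * B X₁ X₂ i q * d2^[j - i] ω q := by
  intro j _
  have hX₁' : ∀ᶠ q in nhds p, pev X₁ q ≠ 0 := (analyticAt_pev X₁ p).continuousAt.eventually_ne hX₁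
  have hd1 : d1 ω =ᶠ[nhds p] fun q => -(pev X₂ q / pev X₁ q) * d2 ω q := by
    filter_upwards [hωX, hX₁'] with q hq hne
    rw [Xop] at hq
    field_simp
    linear_combination hq
  filter_upwards [hX₁', hω.eventually_analyticAt, d1_iterate_d2_comm hω j, hd1.iterate_d2 j]
    with q hne hωq hcomm hiter
  have hquot : AnalyticAt ℂ (fun q => pev X₂ q / pev X₁ q) q :=
    (analyticAt_pev X₂ q).div (analyticAt_pev X₁ q) hne
  have hneg (g : ℂ × ℂ → ℂ) : d2^[j] (fun q => -g q) q = -d2^[j] g q := by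
    simp only [iterate_d2_apply]
    exact iteratedDeriv_fun_neg ..
  simp only [neg_mul] at hiter
  rw [hneg, iterate_d2_mul hquot hωq.d2, Finset.sum_range_succ'] at hiter
  simp only [Nat.choose_zero_right, Nat.cast_one, one_mul, Function.iterate_zero, id_eq,
    Nat.sub_zero] at hiter
  rw [← Function.iterate_succ_apply, Function.iterate_succ_apply'] at hiter
  rw [Finset.sum_congr rfl fun i hi => by
    rw [iterate_d2_succ_sub ω (Finset.mem_range.1 hi)]] at hiter
  have hB : ∑ i ∈ Finset.range j, (Nat.choose j (i + 1) : ℂ) * B X₁ X₂ i q * d2^[j - i] ω q =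
      -pev X₁ q * ∑ i ∈ Finset.range j, (Nat.choose j (i + 1) : ℂ) *
        d2^[i + 1] (fun q => pev X₂ q / pev X₁ q) q * d2^[j - i] ω q := by
    rw [Finset.mul_sum]
    refine Finset.sum_congr rfl fun i _ => ?_
    rw [B]
    ring
  rw [hB, Xop, hcomm, hiter]
  field_simp
  ring
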